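/- arXiv:1806.01471 — 7 statements merged into one kernel-verified Lean document; each statement's English description precedes it below -/
import Mathlib

section
/- For every hypothesis h : X → {−1,1}, every adversarial constraint R with nonempty neighborhoods, every label c ∈ {−1,1}, and every x ∈ X, one has max_{y ∈ N(x)} 1(h(y) ≠ c) = 1(κ_R(h)(x) ≠ c); consequently, for every probability measure P on X × {−1,1}, the adversarial risk of h under R equals the ordinary (identity-adversary) risk of the corrupted hypothesis: L_P(h,R) = L_P(κ_R(h), I_X), where I_X = {(x,x) : x ∈ X} is the identity relation. -/
open MeasureTheory

attribute [local instance] Classical.propDecidable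

/-- The corrupted hypothesis `κ_R(h) : X → {-1, 1, ⊥}`, encoded with values in
`Option ℤ`: it maps `x` to `some c` (for `c ∈ {-1,1}`) if `h y = c` for every `y` in
the neighborhood `N(x) = {y | (x,y) ∈ R}`, and to `none` (i.e. `⊥`) otherwise. -/
noncomputable def corrupt {X : Type*} (R : Set (X × X)) (h : X → ℤ) (x : X) : Option ℤ :=
  if ∀ y : X, (x, y) ∈ R → h y = 1 then some 1
  else if ∀ y : X, (x, y) ∈ R → h y = -1 then some (-1)
  else none

/-- The identity relation `I_X = {(x,x) : x ∈ X}`. -/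
def idRel' (X : Type*) : Set (X × X) := {p : X × X | p.2 = p.1}

/-- The corrupted hypothesis predicts `c` at `x` iff `h` is constantly `c` on the
neighborhood of `x`. -/
theorem corrupt_eq_some_iff {X : Type*} {R : Set (X × X)} {h : X → ℤ} {x : X}
    (hval : ∀ x, h x = -1 ∨ h x = 1) (hne : ∃ y : X, (x, y) ∈ R) (c : ℤ) :
    corrupt R h x = some c ↔ ∀ y : X, (x, y) ∈ R → h y = c := by
  obtain ⟨z, hz⟩ := hne
  unfold corrupt
  split_ifs with h₁ h₂
  · rw [Option.some_inj]
    exact ⟨fun hc => hc ▸ h₁, fun hc => (h₁ z hz).symm.trans (hc z hz)⟩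
  · rw [Option.some_inj]
    exact ⟨fun hc => hc ▸ h₂, fun hc => (h₂ z hz).symm.trans (hc z hz)⟩
  · refine iff_of_false (by simp) fun hc => ?_
    rcases hval z with hv | hv
    · exact h₂ ((hc z hz).symm.trans hv ▸ hc)
    · exact h₁ ((hc z hz).symm.trans hv ▸ hc)

/-- Some neighbor of `x` is misclassified iff the corrupted hypothesis errs at `x`. -/
theorem exists_ne_iff_corrupt_ne {X : Type*} {R : Set (X × X)} {h : X → ℤ} {x : X}
    (hval : ∀ x, h x = -1 ∨ h x = 1) (hne : ∃ y : X, (x, y) ∈ R) (c : ℤ) :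
    (∃ y : X, (x, y) ∈ R ∧ h y ≠ c) ↔ corrupt R h x ≠ some c := by
  rw [Ne, corrupt_eq_some_iff hval hne]
  push Not
  rfl

/-- **Pointwise loss equivalence and risk equivalence between a hypothesis facing an
adversary and its corrupted hypothesis facing no adversary.**  Labels are integers in
`{-1,1}`; `⊥` (i.e. `none`) is counted as unequal to both labels.  The first claim is
`max_{y ∈ N(x)} 1(h(y) ≠ c) = 1(κ_R(h)(x) ≠ c)` (the max of the indicator being `1`
iff some `y ∈ N(x)` has `h y ≠ c`); the second is `L_P(h,R) = L_P(κ_R(h), I_X)`. -/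
theorem adversarial_risk_eq_corrupted_risk
    {X : Type*} [MeasurableSpace X]
    (h : X → ℤ)
    (hmeas : Measurable h)
    (hval : ∀ x, h x = -1 ∨ h x = 1)
    (R : Set (X × X))
    (hne : ∀ x : X, ∃ y : X, (x, y) ∈ R) :
    (∀ c : ℤ, (c = -1 ∨ c = 1) → ∀ x : X,
      (if ∃ y : X, (x, y) ∈ R ∧ h y ≠ c then (1 : ℕ) else 0) =
        (if corrupt R h x ≠ some c then (1 : ℕ) else 0)) ∧
    ∀ (P : Measure (X × ℤ)), IsProbabilityMeasure P →
      P {p : X × ℤ | ∃ y : X, (p.1, y) ∈ R ∧ h y ≠ p.2} =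
        P {p : X × ℤ | ∃ y : X, (p.1, y) ∈ idRel' X ∧ corrupt R h y ≠ some p.2} := by
  refine ⟨fun c _ x => by simp only [exists_ne_iff_corrupt_ne hval (hne x)], fun P _ => ?_⟩
  congr 1
  ext p
  simp [idRel', exists_ne_iff_corrupt_ne hval (hne p.1)]
end

section
/- Let H be the family of halfspace classifiers of ℝ^d, let B ⊆ ℝ^d be a nonempty, closed, convex, origin-symmetric set, and let R = {(x,y) : y − x ∈ B}. Then the adversarial VC dimension satisfies AVC(H,R) = d + 1 − dim(V_B), where V_B is the largest linear subspace contained in B. -/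
open scoped RealInnerProductSpace ENNReal

attribute [local instance] Classical.propDecidable

/-- The sign function with values in `{-1, 1, ⊥}`, encoded in `Option ℤ`:
`sgn t = some 1` for `t > 0`, `some (-1)` for `t < 0`, and `none` (i.e. `⊥`) for `t = 0`. -/
noncomputable def sgn' (t : ℝ) : Option ℤ :=
  if 0 < t then some 1 else if t < 0 then some (-1) else none

/-- The halfspace classifier on `ℝ^d` determined by `(a, b)`: `x ↦ sgn(aᵀx − b)`. -/
noncomputable def halfspace {d : ℕ} (a : EuclideanSpace ℝ (Fin d)) (b : ℝ) :
    EuclideanSpace ℝ (Fin d) → Option ℤ :=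
  fun x => sgn' (⟪a, x⟫ - b)

/-- The corrupted hypothesis `κ_R(h)` for the constraint `R = {(x,y) : y − x ∈ B}`
(so `N(x) = x + B`): it maps `x` to `some c` (for `c ∈ {-1,1}`) if `h y = some c` for
all `y ∈ N(x)`, and to `none` (i.e. `⊥`) otherwise. -/
noncomputable def corruptB {d : ℕ} (B : Set (EuclideanSpace ℝ (Fin d)))
    (h : EuclideanSpace ℝ (Fin d) → Option ℤ) (x : EuclideanSpace ℝ (Fin d)) : Option ℤ :=
  if ∀ y, y - x ∈ B → h y = some 1 then some 1
  else if ∀ y, y - x ∈ B → h y = some (-1) then some (-1)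
  else none

/-- The corrupted loss class of the halfspace classifiers,
`{(y,c) ↦ 1(κ_R(h)(y) ≠ c) : h halfspace}` with `1(⊥ ≠ c) = 1`, achieves all `2^n` loss
patterns on some `n`-tuple of labeled points in `ℝ^d × {-1,1}`. -/
def halfspaceCorruptShatters (d : ℕ) (B : Set (EuclideanSpace ℝ (Fin d))) (n : ℕ) : Prop :=
  ∃ (x : Fin n → EuclideanSpace ℝ (Fin d)) (c : Fin n → ℤ),
    (∀ j : Fin n, c j = -1 ∨ c j = 1) ∧
    ∀ η : Fin n → Bool, ∃ (a : EuclideanSpace ℝ (Fin d)) (b : ℝ),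
      ∀ j : Fin n, (corruptB B (halfspace a b) (x j) ≠ some (c j)) ↔ η j = true

theorem halfspace_eq_some_iff {d : ℕ} (a : EuclideanSpace ℝ (Fin d)) (b : ℝ)
    (y : EuclideanSpace ℝ (Fin d)) {c : ℤ} (hc : c = -1 ∨ c = 1) :
    halfspace a b y = some c ↔ 0 < (c : ℝ) * (⟪a, y⟫ - b) := by
  unfold halfspace sgn'
  rcases hc with rfl | rfl <;> split_ifs <;> simp <;> linarith

/-- A corrupted halfspace classifier outputs the label `c` exactly when the whole
neighborhood lies strictly on the side of `c`. -/
theorem corruptB_halfspace_eq_some_iff {d : ℕ} {B : Set (EuclideanSpace ℝ (Fin d))}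
    (h0 : (0 : EuclideanSpace ℝ (Fin d)) ∈ B) (a : EuclideanSpace ℝ (Fin d)) (b : ℝ)
    (x : EuclideanSpace ℝ (Fin d)) {c : ℤ} (hc : c = -1 ∨ c = 1) :
    corruptB B (halfspace a b) x = some c ↔
      ∀ z ∈ B, 0 < (c : ℝ) * (⟪a, x⟫ + ⟪a, z⟫ - b) := by
  have key : corruptB B (halfspace a b) x = some c ↔
      ∀ y, y - x ∈ B → halfspace a b y = some c := by
    unfold corruptB
    rcases hc with rfl | rfl
    · split_ifs with h1 h2
      · have := h1 x (by simpa using h0)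
        simp only [Option.some.injEq]
        refine ⟨fun h => by norm_num at h, fun h => ?_⟩
        have h' := h x (by simpa using h0)
        rw [this] at h'
        simp at h'
      · simpa using h2
      · simpa using h2
    · split_ifs with h1 h2
      · simpa using h1
      · simpa using h1
      · simpa using h1
  rw [key]
  constructor
  · intro h z hz
    have := (halfspace_eq_some_iff a b (x + z) hc).1 (h (x + z) (by simpa using hz))
    rwa [inner_add_right] at this
  · intro h y hy
    rw [halfspace_eq_some_iff a b y hc]
    have := h _ hy
    rwa [← inner_add_right, add_sub_cancel] at this

/-- If `V` contains every subspace contained in the closed convex symmetric set `B`, then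
`B ∩ Vᗮ` is bounded. -/
theorem exists_norm_bound_of_maximal_subspace {E : Type*} [NormedAddCommGroup E]
    [InnerProductSpace ℝ E] [FiniteDimensional ℝ E] {B : Set E} (hBcl : IsClosed B)
    (hBconv : Convex ℝ B) (hBsym : ∀ z ∈ B, -z ∈ B) (h0 : (0 : E) ∈ B) {V : Submodule ℝ E}
    (hVmax : ∀ W : Submodule ℝ E, (W : Set E) ⊆ B → W ≤ V) :
    ∃ C : ℝ, 0 ≤ C ∧ ∀ z ∈ B, z ∈ Vᗮ → ‖z‖ ≤ C := by
  by_contra! hcon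
  choose z hzB hzV hz using fun n : ℕ => hcon n n.cast_nonneg
  have hpos : ∀ n, 0 < ‖z n‖ := fun n => (Nat.cast_nonneg n).trans_lt (hz n)
  have hsph : ∀ n, ‖z n‖⁻¹ • z n ∈ Metric.sphere (0 : E) 1 := fun n => by
    simp [norm_smul, (hpos n).ne']
  obtain ⟨u, hu, φ, hφ, hlim⟩ := (isCompact_sphere (0 : E) 1).tendsto_subseq hsph
  have hscale : ∀ t : ℝ, ∀ w ∈ B, |t| ≤ 1 → t • w ∈ B := by
    intro t w hw ht
    have hnn : ∀ s : ℝ, 0 ≤ s → s ≤ 1 → s • w ∈ B := fun s hs hs1 =>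
      hBconv.smul_mem_of_zero_mem h0 hw ⟨hs, hs1⟩
    rcases abs_cases t with ⟨h, h'⟩ | ⟨h, h'⟩
    · exact hnn t h' (h ▸ ht)
    · have := hBsym _ (hnn (-t) (by linarith) (h ▸ ht))
      simpa using this
  have hline : ∀ t : ℝ, t • u ∈ B := by
    intro t
    refine hBcl.mem_of_tendsto (hlim.const_smul t) ?_
    filter_upwards [Filter.eventually_ge_atTop ⌈|t|⌉₊] with n hn
    simp only [Function.comp_apply, smul_smul]
    refine hscale _ _ (hzB _) ?_
    have h1 : |t| ≤ ‖z (φ n)‖ := by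
      have h2 : |t| ≤ n := (Nat.le_ceil _).trans (by exact_mod_cast hn)
      have h3 : (n : ℝ) ≤ φ n := by exact_mod_cast hφ.id_le n
      linarith [hz (φ n)]
    rw [abs_mul, abs_inv, abs_norm, ← div_eq_mul_inv]
    exact (div_le_one (hpos _)).2 h1
  have huV : u ∈ V := by
    refine hVmax (Submodule.span ℝ {u}) ?_ (Submodule.mem_span_singleton_self u)
    intro w hw
    obtain ⟨t, rfl⟩ := Submodule.mem_span_singleton.1 hw
    exact hline t
  have huV' : u ∈ Vᗮ := by
    refine (Submodule.isClosed_orthogonal V).mem_of_tendsto hlim (Filter.Eventually.of_forall ?_)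
    exact fun n => Vᗮ.smul_mem _ (hzV _)
  have : u = 0 := inner_self_eq_zero.1 (Submodule.inner_right_of_mem_orthogonal huV huV')
  simp [this] at hu

/-- Linear functionals orthogonal to the largest subspace `V ⊆ B` are bounded on `B`. -/
theorem exists_inner_bound_of_maximal_subspace {E : Type*} [NormedAddCommGroup E]
    [InnerProductSpace ℝ E] [FiniteDimensional ℝ E] {B : Set E} (hBcl : IsClosed B)
    (hBconv : Convex ℝ B) (hBsym : ∀ z ∈ B, -z ∈ B) (h0 : (0 : E) ∈ B) {V : Submodule ℝ E}
    (hVB : (V : Set E) ⊆ B) (hVmax : ∀ W : Submodule ℝ E, (W : Set E) ⊆ B → W ≤ V) :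
    ∃ C : ℝ, 0 ≤ C ∧ ∀ u ∈ Vᗮ, ∀ z ∈ B, |⟪u, z⟫| ≤ ‖u‖ * C := by
  obtain ⟨C, hC, hb⟩ := exists_norm_bound_of_maximal_subspace hBcl hBconv hBsym h0 hVmax
  refine ⟨2 * C, by positivity, fun u hu z hz => ?_⟩
  obtain ⟨v, hv, w, hw, rfl⟩ := V.exists_add_mem_mem_orthogonal z
  have hhalf : (1 / 2 : ℝ) • w ∈ B := by
    have := hBconv hz (hVB (V.neg_mem hv)) (a := 1 / 2) (b := 1 / 2) (by norm_num) (by norm_num)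
      (by norm_num)
    convert this using 1
    module
  have hnorm := hb _ hhalf (Vᗮ.smul_mem _ hw)
  rw [norm_smul] at hnorm
  norm_num at hnorm
  rw [inner_add_right, Submodule.inner_left_of_mem_orthogonal hv hu, zero_add]
  exact (abs_real_inner_le_norm u w).trans
    (mul_le_mul_of_nonneg_left (by linarith) (norm_nonneg u))

/-- A linear functional that is one-sidedly bounded on a subspace vanishes there. -/
theorem mem_orthogonal_of_forall_inner_bound {E : Type*} [NormedAddCommGroup E]
    [InnerProductSpace ℝ E] {V : Submodule ℝ E} {a : E} {c r : ℝ}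
    (h : ∀ v ∈ V, 0 < c * (⟪a, v⟫ + r)) : a ∈ Vᗮ := by
  rw [Submodule.mem_orthogonal']
  intro v hv
  by_contra hne
  have := h _ (V.smul_mem (-r / ⟪a, v⟫) hv)
  rw [inner_smul_right, div_mul_cancel₀ _ hne] at this
  simp at this

/-- Upper bound: a shattered tuple has at most `d + 1 - dim V` points, for every subspace
`V ⊆ B`. -/
theorem card_le_of_halfspaceCorruptShatters {d : ℕ} {B : Set (EuclideanSpace ℝ (Fin d))}
    (h0 : (0 : EuclideanSpace ℝ (Fin d)) ∈ B) (hBsym : ∀ z ∈ B, -z ∈ B)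
    {V : Submodule ℝ (EuclideanSpace ℝ (Fin d))}
    (hVB : (V : Set (EuclideanSpace ℝ (Fin d))) ⊆ B) {n : ℕ}
    (hn : halfspaceCorruptShatters d B n) : n ≤ d + 1 - Module.finrank ℝ V := by
  obtain ⟨x, c, hc, hsh⟩ := hn
  by_contra! hlt
  have hdep : ¬ LinearIndependent ℝ
      (fun j => ((c j : ℝ) • V.mkQ (x j), (c j : ℝ)) :
        Fin n → (EuclideanSpace ℝ (Fin d) ⧸ V) × ℝ) := by
    intro hli
    have h1 := hli.fintype_card_le_finrank
    have h2 := V.finrank_quotient_add_finrank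
    simp only [Fintype.card_fin, Module.finrank_prod, Module.finrank_self,
      finrank_euclideanSpace] at h1 h2
    omega
  obtain ⟨l, hl, i₀, hi₀⟩ := Fintype.not_linearIndependent_iff.1 hdep
  obtain ⟨l, hl, i₀, hi₀, hsum⟩ : ∃ l : Fin n → ℝ,
      ∑ j, l j • (((c j : ℝ) • V.mkQ (x j), (c j : ℝ)) : (EuclideanSpace ℝ (Fin d) ⧸ V) × ℝ) = 0 ∧
      ∃ i, l i ≠ 0 ∧ 0 ≤ ∑ j, l j := by
    rcases le_total 0 (∑ j, l j) with h | h
    · exact ⟨l, hl, i₀, hi₀, h⟩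
    · refine ⟨-l, ?_, i₀, by simpa using hi₀, by simpa using h⟩
      simp only [Pi.neg_apply, neg_smul, Finset.sum_neg_distrib, hl, neg_zero]
  have hlV : ∑ j, (l j * c j) • x j ∈ V := by
    have := congrArg Prod.fst hl
    rw [← Submodule.ker_mkQ V, LinearMap.mem_ker]
    simpa [Prod.fst_sum, smul_smul] using this
  have hl1 : ∑ j, l j * c j = 0 := by
    simpa [Prod.snd_sum] using congrArg Prod.snd hl
  obtain ⟨i, hi⟩ : ∃ i, 0 < l i := by
    by_contra! hle
    have hs := le_antisymm (Finset.sum_nonpos fun j _ => hle j) hsum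
    exact hi₀ ((Finset.sum_eq_zero_iff_of_nonpos fun j _ => hle j).1 hs i₀ (Finset.mem_univ _))
  obtain ⟨a, b, hab⟩ := hsh fun j => decide (l j ≤ 0)
  simp only [ne_eq, decide_eq_true_eq, corruptB_halfspace_eq_some_iff h0 a b _ (hc _)] at hab
  have hpos : ∀ j, 0 < l j → ∀ z ∈ B, 0 < (c j : ℝ) * (⟪a, x j⟫ + ⟪a, z⟫ - b) := fun j hj => by
    by_contra h
    exact absurd ((hab j).1 h) (not_le.2 hj)
  have hneg : ∀ j, ∃ z ∈ B, l j ≤ 0 → (c j : ℝ) * (⟪a, x j⟫ + ⟪a, z⟫ - b) ≤ 0 := fun j => by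
    by_cases hj : l j ≤ 0
    · have := (hab j).2 hj
      push Not at this
      obtain ⟨z, hz, h⟩ := this
      exact ⟨z, hz, fun _ => h⟩
    · exact ⟨0, h0, fun h => absurd h hj⟩
  choose z hzB hz using hneg
  have haV : a ∈ Vᗮ := by
    refine mem_orthogonal_of_forall_inner_bound (c := c i) (r := ⟪a, x i⟫ - b) fun v hv => ?_
    have := hpos i hi v (hVB hv)
    rwa [show ⟪a, v⟫ + (⟪a, x i⟫ - b) = ⟪a, x i⟫ + ⟪a, v⟫ - b by ring]
  obtain ⟨m, -, hm⟩ := Finset.exists_max_image Finset.univ (fun j => |⟪a, z j⟫|)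
    ⟨i, Finset.mem_univ _⟩
  set M := |⟪a, z m⟫| with hM
  set t : Fin n → ℝ := fun j => c j * (⟪a, x j⟫ - b) with ht
  have htsum : ∑ j, l j * t j = 0 := by
    have h1 := Submodule.inner_left_of_mem_orthogonal hlV haV
    simp only [inner_sum, inner_smul_right] at h1
    calc ∑ j, l j * t j = ∑ j, l j * c j * ⟪a, x j⟫ - (∑ j, l j * c j) * b := by
          rw [Finset.sum_mul, ← Finset.sum_sub_distrib]
          exact Finset.sum_congr rfl fun j _ => by simp only [ht]; ring
      _ = 0 := by rw [h1, hl1]; ring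
  have htpos : ∀ j, 0 < l j → M < t j := fun j hj => by
    have h1 := hpos j hj _ (hzB m)
    have h2 := hpos j hj _ (hBsym _ (hzB m))
    rw [inner_neg_right] at h2
    simp only [ht, hM]
    rcases hc j with h | h <;> rw [h] at h1 h2 ⊢ <;> push_cast at h1 h2 ⊢ <;>
      rcases abs_cases ⟪a, z m⟫ with ⟨h3, _⟩ | ⟨h3, _⟩ <;> rw [h3] <;> linarith
  have htneg : ∀ j, l j ≤ 0 → t j ≤ M := fun j hj => by
    have h1 := hz j hj
    have h2 := abs_le.1 (hm j (Finset.mem_univ _))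
    simp only [ht]
    rcases hc j with h | h <;> rw [h] at h1 ⊢ <;> push_cast at h1 ⊢ <;> linarith [h2.1, h2.2]
  have hlt' : ∑ j, l j * M < ∑ j, l j * t j := by
    refine Finset.sum_lt_sum (fun j _ => ?_)
      ⟨i, Finset.mem_univ _, mul_lt_mul_of_pos_left (htpos i hi) hi⟩
    rcases lt_or_ge 0 (l j) with hj | hj
    · exact mul_le_mul_of_nonneg_left (htpos j hj).le hj.le
    · exact mul_le_mul_of_nonpos_left (htneg j hj) hj
  rw [htsum, ← Finset.sum_mul] at hlt'
  exact absurd hlt' (not_lt.2 (mul_nonneg hsum (abs_nonneg _)))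

/-- Lower bound: if functionals in `U` are bounded on `B`, some `dim U + 1` points are
shattered. -/
theorem halfspaceCorruptShatters_of_inner_bound {d : ℕ} {B : Set (EuclideanSpace ℝ (Fin d))}
    (h0 : (0 : EuclideanSpace ℝ (Fin d)) ∈ B) {U : Submodule ℝ (EuclideanSpace ℝ (Fin d))}
    {C : ℝ} (hC : 0 ≤ C) (hb : ∀ u ∈ U, ∀ z ∈ B, |⟪u, z⟫| ≤ ‖u‖ * C) :
    halfspaceCorruptShatters d B (Module.finrank ℝ U + 1) := by
  set e := stdOrthonormalBasis ℝ U
  set k := Module.finrank ℝ U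
  set s : ℝ := 2 * k * C + 1 with hs
  have hspos : 0 < s := by positivity
  have horth : ∀ i j, ⟪(e i : EuclideanSpace ℝ (Fin d)), (e j : EuclideanSpace ℝ (Fin d))⟫ =
      if i = j then 1 else 0 := fun i j => by
    rw [← Submodule.coe_inner, orthonormal_iff_ite.1 e.orthonormal]
  refine ⟨Fin.cons 0 fun i => s • (e i : EuclideanSpace ℝ (Fin d)), fun _ => 1,
    fun _ => Or.inr rfl, fun η => ?_⟩
  set y : Fin (k + 1) → ℝ := fun j => if η j then -1 else 1 with hy
  have hy1 : ∀ j, |y j| = 1 := fun j => by simp only [hy]; split_ifs <;> simp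
  set a : EuclideanSpace ℝ (Fin d) :=
    ∑ i, ((y (Fin.succ i) - y 0) / s) • (e i : EuclideanSpace ℝ (Fin d)) with ha
  have hval : ∀ j, ⟪a, (Fin.cons 0 fun i => s • (e i : EuclideanSpace ℝ (Fin d)) :
      Fin (k + 1) → EuclideanSpace ℝ (Fin d)) j⟫ - -y 0 = y j := by
    intro j
    refine Fin.cases (by simp) (fun i => ?_) j
    simp only [Fin.cons_succ, ha, sum_inner, inner_smul_left, inner_smul_right, horth]
    simp
    field_simp
    ring
  have hlt : ∀ z ∈ B, |⟪a, z⟫| < 1 := by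
    intro z hz
    have hterm : ∀ i ∈ (Finset.univ : Finset (Fin k)),
        |⟪((y (Fin.succ i) - y 0) / s) • (e i : EuclideanSpace ℝ (Fin d)), z⟫| ≤ 2 / s * C := by
      intro i _
      have h1 := hb _ (e i).2 z hz
      have h2 : ‖(e i : EuclideanSpace ℝ (Fin d))‖ = 1 := e.orthonormal.1 i
      rw [h2, one_mul] at h1
      have h3 : |y (Fin.succ i) - y 0| ≤ 2 :=
        (abs_sub _ _).trans (by rw [hy1, hy1]; norm_num)
      rw [real_inner_smul_left, abs_mul, abs_div, abs_of_pos hspos]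
      gcongr
    have hsum := (Finset.abs_sum_le_sum_abs _ _).trans (Finset.sum_le_sum hterm)
    rw [← sum_inner, ← ha] at hsum
    refine hsum.trans_lt ?_
    rw [Finset.sum_const, Finset.card_univ, Fintype.card_fin, nsmul_eq_mul]
    have : (k : ℝ) * (2 / s * C) = (2 * k * C) / s := by ring
    rw [this, div_lt_one hspos]
    linarith
  refine ⟨a, -y 0, fun j => ?_⟩
  rw [ne_eq, corruptB_halfspace_eq_some_iff h0 a _ _ (Or.inr rfl)]
  have hvj := hval j
  cases hη : η j with
  | true =>
    have : y j = -1 := by simp [hy, hη]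
    simp only [iff_true]
    intro h
    have := h 0 h0
    rw [inner_zero_right] at this
    push_cast at this
    linarith
  | false =>
    have : y j = 1 := by simp [hy, hη]
    simp only [Bool.false_eq_true, iff_false, not_not]
    intro z hz
    have := (abs_lt.1 (hlt z hz)).1
    push_cast
    linarith

/-- **Adversarial VC-dimension of halfspace classifiers.**  For the family of halfspace
classifiers of `ℝ^d` and the adversarial constraint `R = {(x,y) : y − x ∈ B}` derived
from a nonempty, closed, convex, origin-symmetric set `B` whose largest contained linear
subspace is `V`, the adversarial VC-dimension equals `d + 1 − dim V`. -/
theorem adversarial_vc_dimension_halfspaces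
    (d : ℕ) (B : Set (EuclideanSpace ℝ (Fin d)))
    (hBne : B.Nonempty) (hBcl : IsClosed B) (hBconv : Convex ℝ B)
    (hBsym : ∀ z ∈ B, -z ∈ B)
    (V : Submodule ℝ (EuclideanSpace ℝ (Fin d)))
    (hVB : (V : Set (EuclideanSpace ℝ (Fin d))) ⊆ B)
    (hVmax : ∀ W : Submodule ℝ (EuclideanSpace ℝ (Fin d)),
      (W : Set (EuclideanSpace ℝ (Fin d))) ⊆ B → W ≤ V) :
    (⨆ (n : ℕ) (_ : halfspaceCorruptShatters d B n), (n : ℕ∞)) =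
      ((d + 1 - Module.finrank ℝ V : ℕ) : ℕ∞) := by
  have h0 : (0 : EuclideanSpace ℝ (Fin d)) ∈ B := hVB V.zero_mem
  refine le_antisymm (iSup₂_le fun n hn => ?_) ?_
  · exact_mod_cast card_le_of_halfspaceCorruptShatters h0 hBsym hVB hn
  · obtain ⟨C, hC, hb⟩ :=
      exists_inner_bound_of_maximal_subspace hBcl hBconv hBsym h0 hVB hVmax
    have hrank := V.finrank_add_finrank_orthogonal
    rw [finrank_euclideanSpace_fin] at hrank
    have hcard : d + 1 - Module.finrank ℝ V = Module.finrank ℝ Vᗮ + 1 := by omega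
    rw [hcard]
    exact le_iSup₂ (f := fun (n : ℕ) (_ : halfspaceCorruptShatters d B n) => (n : ℕ∞)) _
      (halfspaceCorruptShatters_of_inner_bound h0 hC hb)
end

section
/- Let H be the family of halfspace classifiers of ℝ^d, let B ⊆ ℝ^d be a nonempty, closed, convex, origin-symmetric set with maximal contained linear subspace V_B, and let R = {(x,y) : y − x ∈ B}. Then AVC(H,R) ≥ d + 1 − dim(V_B); concretely, letting t = d − dim(V_B), x₀ = 0, and x₁,…,x_t a basis of the orthogonal complement of V_B, there exists a scaling factor s > 0 such that for every labeling c ∈ {−1,1}^{t+1}, the corrupted loss class of H achieves all 2^{t+1} loss patterns on the labeled points ((s·x₀,c₀),…,(s·x_t,c_t)). -/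
open scoped RealInnerProductSpace ENNReal

attribute [local instance] Classical.propDecidable

section InnerProductSpace

variable {E : Type*} [NormedAddCommGroup E] [InnerProductSpace ℝ E] [FiniteDimensional ℝ E]

theorem Convex.smul_starProjection_orthogonal_mem {B : Set E} (hBconv : Convex ℝ B)
    (hBsym : ∀ z ∈ B, -z ∈ B) {V : Submodule ℝ E} (hVB : (V : Set E) ⊆ B)
    {z : E} (hz : z ∈ B) {θ : ℝ} (hθ : |θ| < 1) : θ • Vᗮ.starProjection z ∈ B := by
  wlog h0 : 0 ≤ θ generalizing θ
  · have := hBsym _ (this (θ := -θ) (by rwa [abs_neg]) (by linarith))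
    simpa using this
  rw [abs_of_nonneg h0] at hθ
  have hv : (-(θ / (1 - θ))) • V.starProjection z ∈ B :=
    hVB (V.smul_mem _ (V.starProjection_apply_mem z))
  convert hBconv hz hv h0 (sub_nonneg.2 hθ.le) (by ring) using 1
  have h1 : (1 - θ) * -(θ / (1 - θ)) = -θ := by
    have : 1 - θ ≠ 0 := by linarith
    field_simp
  rw [smul_smul, h1, V.starProjection_orthogonal_val, smul_sub, neg_smul, sub_eq_add_neg]

/-- The projection of a closed, convex, symmetric set onto the orthogonal complement of its
largest linear subspace is bounded. -/
theorem exists_norm_starProjection_orthogonal_le {B : Set E} (hBcl : IsClosed B)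
    (hBconv : Convex ℝ B) (hBsym : ∀ z ∈ B, -z ∈ B) {V : Submodule ℝ E} (hVB : (V : Set E) ⊆ B)
    (hVmax : ∀ W : Submodule ℝ E, (W : Set E) ⊆ B → W ≤ V) :
    ∃ M : ℝ, ∀ z ∈ B, ‖Vᗮ.starProjection z‖ ≤ M := by
  by_contra! hunb
  choose z hzB hz using fun n : ℕ => hunb n
  have hpos : ∀ n, 0 < ‖Vᗮ.starProjection (z n)‖ := fun n => n.cast_nonneg.trans_lt (hz n)
  obtain ⟨u, hu, φ, hφ, hlim⟩ := (isCompact_sphere (0 : E) 1).tendsto_subseq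
    (x := fun n => ‖Vᗮ.starProjection (z n)‖⁻¹ • Vᗮ.starProjection (z n)) (fun n => by
      rw [mem_sphere_zero_iff_norm, norm_smul, norm_inv, norm_norm,
        inv_mul_cancel₀ (hpos n).ne'])
  have hline : ∀ r : ℝ, r • u ∈ B := by
    intro r
    refine hBcl.mem_of_tendsto (hlim.const_smul r) ?_
    filter_upwards [Filter.eventually_ge_atTop ⌈|r|⌉₊] with n hn
    rw [Function.comp_apply, smul_smul]
    refine hBconv.smul_starProjection_orthogonal_mem hBsym hVB (hzB _) ?_
    rw [abs_mul, abs_inv, abs_norm, ← div_eq_mul_inv, div_lt_one (hpos _)]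
    calc |r| ≤ n := Nat.ceil_le.1 hn
      _ ≤ φ n := by exact_mod_cast hφ.le_apply
      _ < _ := hz _
  have huV : u ∈ V := by
    refine hVmax (ℝ ∙ u) ?_ (Submodule.mem_span_singleton_self u)
    rintro w hw
    obtain ⟨r, rfl⟩ := Submodule.mem_span_singleton.1 hw
    exact hline r
  have huV' : u ∈ Vᗮ :=
    Vᗮ.closed_of_finiteDimensional.mem_of_tendsto hlim
      (.of_forall fun n => Vᗮ.smul_mem _ (Vᗮ.starProjection_apply_mem _))
  have hu0 : u = 0 := by
    exact Submodule.disjoint_def.1 V.orthogonal_disjoint u huV huV'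
  simp [hu0] at hu

theorem LinearIndependent.exists_mem_inner_eq {ι : Type*} {v : ι → E}
    (hv : LinearIndependent ℝ v) {W : Submodule ℝ E} (hvW : ∀ i, v i ∈ W) (g : ι → ℝ) :
    ∃ a ∈ W, ∀ i, ⟪a, v i⟫ = g i := by
  obtain ⟨f, hf⟩ := LinearMap.exists_extend ((Module.Basis.span hv).constr ℝ g)
  refine ⟨W.starProjection ((InnerProductSpace.toDual ℝ E).symm (LinearMap.toContinuousLinearMap f)),
    W.starProjection_apply_mem _, fun i => ?_⟩
  rw [W.inner_starProjection_left_eq_right, Submodule.starProjection_eq_self_iff.2 (hvW i),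
    InnerProductSpace.toDual_symm_apply]
  have h := LinearMap.congr_fun hf (Module.Basis.span hv i)
  rw [Module.Basis.constr_basis] at h
  simpa [Module.Basis.span_apply] using h

end InnerProductSpace

theorem corruptB_halfspace_eq_some_one {d : ℕ} {B : Set (EuclideanSpace ℝ (Fin d))}
    {a x : EuclideanSpace ℝ (Fin d)} {b : ℝ} (h : ∀ z ∈ B, 0 < ⟪a, x + z⟫ - b) :
    corruptB B (halfspace a b) x = some 1 := by
  refine if_pos fun y hy => if_pos ?_
  simpa using h _ hy

theorem corruptB_halfspace_eq_some_neg_one {d : ℕ} {B : Set (EuclideanSpace ℝ (Fin d))}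
    (h0 : 0 ∈ B) {a x : EuclideanSpace ℝ (Fin d)} {b : ℝ} (h : ∀ z ∈ B, ⟪a, x + z⟫ - b < 0) :
    corruptB B (halfspace a b) x = some (-1) := by
  have key : ∀ y, y - x ∈ B → halfspace a b y = some (-1) := by
    intro y hy
    have hlt : ⟪a, y⟫ - b < 0 := by simpa using h _ hy
    exact (if_neg hlt.not_gt).trans (if_pos hlt)
  have hx : x - x ∈ B := by simpa using h0
  refine (if_neg fun hpos => ?_).trans (if_pos key)
  exact absurd ((hpos x hx).symm.trans (key x hx)) (by decide)

/-- Affinely independent points can be scaled so far apart that every sign vector is realized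
on them by a corrupted halfspace. -/
theorem exists_scaling_forall_corruptB_halfspace_eq {d t : ℕ}
    {B : Set (EuclideanSpace ℝ (Fin d))} (hBcl : IsClosed B) (hBconv : Convex ℝ B)
    (hBsym : ∀ z ∈ B, -z ∈ B) {V : Submodule ℝ (EuclideanSpace ℝ (Fin d))}
    (hVB : (V : Set (EuclideanSpace ℝ (Fin d))) ⊆ B)
    (hVmax : ∀ W : Submodule ℝ (EuclideanSpace ℝ (Fin d)),
      (W : Set (EuclideanSpace ℝ (Fin d))) ⊆ B → W ≤ V)
    {x : Fin (t + 1) → EuclideanSpace ℝ (Fin d)} (hx0 : x 0 = 0)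
    (hli : LinearIndependent ℝ (fun i : Fin t => x i.succ)) (hxV : ∀ i : Fin t, x i.succ ∈ Vᗮ) :
    ∃ s : ℝ, 0 < s ∧ ∀ y : Fin (t + 1) → Bool, ∃ (a : EuclideanSpace ℝ (Fin d)) (b : ℝ),
      ∀ j, corruptB B (halfspace a b) (s • x j) = some (if y j then 1 else -1) := by
  obtain ⟨M, hM⟩ := exists_norm_starProjection_orthogonal_le hBcl hBconv hBsym hVB hVmax
  have hB0 : (0 : EuclideanSpace ℝ (Fin d)) ∈ B := hVB V.zero_mem
  have hM0 : 0 ≤ M := (norm_nonneg _).trans (hM 0 hB0)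
  let σ : Bool → ℝ := fun p => if p then 1 else -1
  choose a haV ha using fun y : Fin (t + 1) → Bool =>
    hli.exists_mem_inner_eq hxV (fun i => σ (y i.succ) - σ (y 0))
  obtain ⟨N, hN⟩ := (Set.finite_range fun y => ‖a y‖).bddAbove
  have hN' : ∀ y, ‖a y‖ ≤ N := fun y => hN ⟨y, rfl⟩
  have hN0 : 0 ≤ N := (norm_nonneg _).trans (hN' fun _ => true)
  have hs : 0 < N * M + 1 := by positivity
  refine ⟨N * M + 1, hs, fun y => ⟨(N * M + 1)⁻¹ • a y, -σ (y 0), fun j => ?_⟩⟩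
  have hval : ∀ j, ⟪a y, x j⟫ = σ (y j) - σ (y 0) := by
    refine Fin.cases ?_ (ha y)
    simp [hx0]
  have hbound : ∀ z ∈ B, |⟪(N * M + 1)⁻¹ • a y, (N * M + 1) • x j + z⟫ - -σ (y 0) - σ (y j)| < 1 := by
    intro z hz
    have hproj : ⟪a y, z⟫ = ⟪a y, Vᗮ.starProjection z⟫ := by
      rw [← Vᗮ.inner_starProjection_left_eq_right,
        Submodule.starProjection_eq_self_iff.2 (haV y)]
    have heq : ⟪(N * M + 1)⁻¹ • a y, (N * M + 1) • x j + z⟫ - -σ (y 0) - σ (y j)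
        = ⟪a y, Vᗮ.starProjection z⟫ / (N * M + 1) := by
      rw [inner_add_right, real_inner_smul_left, real_inner_smul_left, real_inner_smul_right,
        hval, hproj]
      field_simp
      ring
    rw [heq, abs_div, abs_of_pos hs, div_lt_one hs]
    calc _ ≤ ‖a y‖ * ‖Vᗮ.starProjection z‖ := abs_real_inner_le_norm _ _
      _ ≤ N * M := mul_le_mul (hN' y) (hM z hz) (norm_nonneg _) hN0
      _ < _ := lt_add_one _
  cases hy : y j with
  | true =>
    refine corruptB_halfspace_eq_some_one fun z hz => ?_
    have h := abs_lt.1 (hbound z hz)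
    simp only [hy, σ, if_true] at h ⊢
    linarith [h.1]
  | false =>
    refine corruptB_halfspace_eq_some_neg_one hB0 fun z hz => ?_
    have h := abs_lt.1 (hbound z hz)
    simp only [hy, σ, Bool.false_eq_true, if_false] at h ⊢
    linarith [h.2]

/-- **Lower bound on the adversarial VC-dimension of halfspace classifiers:**
`AVC(H,R) ≥ d + 1 − dim V_B`.  Concretely, with `t = d − dim V_B`, `x 0 = 0`, and
`x 1, …, x t` a basis of the orthogonal complement of `V_B`, there is a scaling `s > 0`
such that for every labeling `c ∈ {-1,1}^{t+1}`, the corrupted loss class of the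
halfspace classifiers achieves all `2^{t+1}` loss patterns on the labeled points
`((s • x 0, c 0), …, (s • x t, c t))`. -/
theorem adversarial_vc_dimension_halfspaces_lower_bound
    (d : ℕ) (B : Set (EuclideanSpace ℝ (Fin d)))
    (hBne : B.Nonempty) (hBcl : IsClosed B) (hBconv : Convex ℝ B)
    (hBsym : ∀ z ∈ B, -z ∈ B)
    (V : Submodule ℝ (EuclideanSpace ℝ (Fin d)))
    (hVB : (V : Set (EuclideanSpace ℝ (Fin d))) ⊆ B)
    (hVmax : ∀ W : Submodule ℝ (EuclideanSpace ℝ (Fin d)),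
      (W : Set (EuclideanSpace ℝ (Fin d))) ⊆ B → W ≤ V)
    (x : Fin (d - Module.finrank ℝ V + 1) → EuclideanSpace ℝ (Fin d))
    (hx0 : x 0 = 0)
    (hli : LinearIndependent ℝ (fun i : Fin (d - Module.finrank ℝ V) => x i.succ))
    (hspan : Submodule.span ℝ
      (Set.range fun i : Fin (d - Module.finrank ℝ V) => x i.succ) = Vᗮ) :
    (((d + 1 - Module.finrank ℝ V : ℕ) : ℕ∞) ≤
        ⨆ (n : ℕ) (_ : halfspaceCorruptShatters d B n), (n : ℕ∞)) ∧
      ∃ s : ℝ, 0 < s ∧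
        ∀ c : Fin (d - Module.finrank ℝ V + 1) → ℤ,
          (∀ j, c j = -1 ∨ c j = 1) →
          ∀ η : Fin (d - Module.finrank ℝ V + 1) → Bool,
            ∃ (a : EuclideanSpace ℝ (Fin d)) (b : ℝ),
              ∀ j, (corruptB B (halfspace a b) (s • x j) ≠ some (c j)) ↔ η j = true := by
  obtain ⟨s, hs, hsign⟩ := exists_scaling_forall_corruptB_halfspace_eq hBcl hBconv hBsym hVB hVmax
    hx0 hli fun i => hspan ▸ Submodule.subset_span ⟨i, rfl⟩
  have hpattern : ∀ c : Fin (d - Module.finrank ℝ V + 1) → ℤ, (∀ j, c j = -1 ∨ c j = 1) →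
      ∀ η : Fin (d - Module.finrank ℝ V + 1) → Bool, ∃ (a : EuclideanSpace ℝ (Fin d)) (b : ℝ),
        ∀ j, (corruptB B (halfspace a b) (s • x j) ≠ some (c j)) ↔ η j = true := by
    intro c hc η
    obtain ⟨a, b, hab⟩ := hsign fun j => xor (η j) (decide (c j = 1))
    refine ⟨a, b, fun j => ?_⟩
    rw [hab]
    rcases hc j with h | h <;> cases η j <;> simp [h]
  refine ⟨?_, s, hs, hpattern⟩
  have hdim : Module.finrank ℝ V ≤ d := by
    simpa using V.finrank_le
  rw [Nat.sub_add_comm hdim]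
  exact le_iSup₂_of_le _ ⟨fun j => s • x j, fun _ => 1, fun _ => .inr rfl,
    hpattern _ fun _ => .inr rfl⟩ le_rfl
end

section
/- Let U be a linear subspace of ℝ^n with dim(U) < n. Then the map from U to {0,1}^n sending z to the pattern (1(z₀ ≤ 1), …, 1(z_{n−1} ≤ 1)) is not surjective; that is, there exists η ∈ {0,1}^n such that no z ∈ U satisfies (z_i ≤ 1 ⟺ η_i = 1) for all i. -/
/-- A proper subspace of `ℝ^n` lies in the kernel of a nonzero linear functional which is nonnegative
at the all-ones vector. -/
lemma exists_functional_nonneg_at_one {n : ℕ} {U : Submodule ℝ (Fin n → ℝ)} (hU : U < ⊤) :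
    ∃ f : (Fin n → ℝ) →ₗ[ℝ] ℝ, f ≠ 0 ∧ U ≤ LinearMap.ker f ∧ 0 ≤ f 1 := by
  obtain ⟨f, hf, hle⟩ := U.exists_le_ker_of_lt_top hU
  rcases le_total 0 (f 1) with h | h
  · exact ⟨f, hf, hle, h⟩
  · refine ⟨-f, neg_ne_zero.mpr hf, fun z hz => ?_, by simpa using h⟩
    simpa using hle hz

/-- **A proper subspace of `ℝ^n` misses some threshold pattern.**  If `U` is a linear
subspace of `ℝ^n` with `dim U < n`, then the map sending `z ∈ U` to the pattern
`(1(z₀ ≤ 1), …, 1(z_{n−1} ≤ 1))` is not surjective onto `{0,1}^n`: some pattern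
`η` is achieved by no `z ∈ U`. -/
theorem proper_subspace_misses_a_pattern
    (n : ℕ) (U : Submodule ℝ (Fin n → ℝ))
    (hU : Module.finrank ℝ U < n) :
    ∃ η : Fin n → Bool, ∀ z ∈ U, ∃ i : Fin n, ¬ (z i ≤ 1 ↔ η i = true) := by
  have hlt : U < ⊤ :=
    Submodule.lt_top_of_finrank_lt_finrank (by simpa using hU)
  obtain ⟨f, hf, hle, h1⟩ := exists_functional_nonneg_at_one hlt
  set w : Fin n → ℝ := fun i => f (Pi.single i 1) with hw
  have hsum (z : Fin n → ℝ) : f z = ∑ i, z i * w i := by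
    rw [f.pi_apply_eq_sum_univ z]
    refine Finset.sum_congr rfl fun i _ => ?_
    rw [smul_eq_mul, hw]
    congr 2
    ext j
    simp [Pi.single_apply, eq_comm]
  refine ⟨fun i => decide (w i < 0), fun z hz => ?_⟩
  by_contra! hpat
  simp only [decide_eq_true_eq] at hpat
  have hterm (i : Fin n) : 0 ≤ (z i - 1) * w i := by
    rcases lt_or_ge (w i) 0 with h | h
    · exact mul_nonneg_of_nonpos_of_nonpos (sub_nonpos.mpr ((hpat i).mpr h)) h.le
    · have : 1 < z i := not_le.mp fun hzi => h.not_gt ((hpat i).mp hzi)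
      exact mul_nonneg (sub_nonneg.mpr this.le) h
  have hdiff : ∑ i, (z i - 1) * w i = - f 1 := by
    have hfz : f z = 0 := hle hz
    rw [← zero_sub, ← hfz, hsum z, hsum 1, ← Finset.sum_sub_distrib]
    simp [sub_mul]
  have hzero : ∑ i, (z i - 1) * w i = 0 :=
    le_antisymm (by linarith) (Finset.sum_nonneg fun i _ => hterm i)
  have hw_nonpos (i : Fin n) : w i ≤ 0 := by
    by_contra! h
    have hi := (Finset.sum_eq_zero_iff_of_nonneg fun i _ => hterm i).mp hzero i (Finset.mem_univ i)
    have hzi : z i = 1 := sub_eq_zero.mp ((mul_eq_zero.mp hi).resolve_right h.ne')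
    exact h.not_gt ((hpat i).mp hzi.le)
  have hwsum : ∑ i, w i = 0 := by
    have := hsum 1
    simp only [Pi.one_apply, one_mul] at this
    linarith
  have hw_zero (i : Fin n) : w i = 0 :=
    (Finset.sum_eq_zero_iff_of_nonpos fun i _ => hw_nonpos i).mp hwsum i (Finset.mem_univ i)
  exact hf (LinearMap.ext fun x => by simp [hsum x, hw_zero])
end

section
/- Let X = ℤ^d, let H = {h_z : z ∈ ℤ^d} be the family of point indicator classifiers (h_z(y) = 1 if y = z, else −1), and let R = {(x,y) ∈ ℤ^d × ℤ^d : ‖x − y‖_∞ ≤ 1}. Define x₀,…,x_{d−1} ∈ ℤ^d by (x_i)_j = −1 if i = j and (x_i)_j = 1 otherwise, all labeled with c_i = −1. Then the corrupted loss class of H achieves all 2^d loss patterns on ((x₀,−1),…,(x_{d−1},−1)): for every η ∈ {0,1}^d there is y ∈ {0,1}^d ⊆ ℤ^d such that 1(κ_R(h_y)(x_i) ≠ −1) = η_i for all i. Consequently AVC(H,R) ≥ d. -/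
attribute [local instance] Classical.propDecidable

/-- The corrupted loss class `{(y,c) ↦ 1(κ_R(h)(y) ≠ c) : h ∈ H}` achieves all `2^n`
loss patterns on some `n`-tuple of labeled points in `X × {-1,1}` (with `1(⊥ ≠ c) = 1`).
The adversarial VC dimension `AVC(H,R)` is the supremum of such `n`. -/
def corruptShatters {X : Type*} (H : Set (X → ℤ)) (R : Set (X × X)) (n : ℕ) : Prop :=
  ∃ (x : Fin n → X) (c : Fin n → ℤ),
    (∀ j : Fin n, c j = -1 ∨ c j = 1) ∧
    ∀ η : Fin n → Bool, ∃ h ∈ H,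
      ∀ j : Fin n, (corrupt R h (x j) ≠ some (c j)) ↔ η j = true

/-- The point indicator classifier `h_z : ℤ^d → {-1, 1}`. -/
def pointInd {d : ℕ} (z : Fin d → ℤ) : (Fin d → ℤ) → ℤ :=
  fun y => if y = z then 1 else -1

/-- On a point `x` with nonempty neighborhood, the corrupted indicator of `z` differs from `-1`
exactly when `z` is a neighbor of `x`. -/
theorem corrupt_pointInd_ne_neg_one_iff {d : ℕ} {R : Set ((Fin d → ℤ) × (Fin d → ℤ))}
    {x z : Fin d → ℤ} (hx : ∃ y, (x, y) ∈ R) :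
    corrupt R (pointInd z) x ≠ some (-1) ↔ (x, z) ∈ R := by
  have key : (∀ y, (x, y) ∈ R → pointInd z y = -1) ↔ (x, z) ∉ R := by
    constructor
    · intro h hz
      simpa [pointInd] using h z hz
    · intro hz y hy
      have hyz : y ≠ z := fun h => hz (h ▸ hy)
      simp [pointInd, hyz]
  unfold corrupt
  split_ifs with h₁ h₂
  · refine ⟨fun _ => ?_, fun _ => by simp⟩
    by_contra hz
    obtain ⟨y, hy⟩ := hx
    have := h₁ y hy
    rw [key.2 hz y hy] at this
    norm_num at this
  · simpa using key.1 h₂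
  · simpa using mt key.2 h₂

/-- The points with a single coordinate `-1` and all others `1` realize every loss pattern,
using indicators of vertices of the unit cube. -/
theorem exists_cube_vertex_corrupt_iff {d : ℕ} (η : Fin d → Bool) :
    ∃ y : Fin d → ℤ, (∀ j : Fin d, y j = 0 ∨ y j = 1) ∧
      ∀ i : Fin d,
        (corrupt {p : (Fin d → ℤ) × (Fin d → ℤ) | ∀ j : Fin d, |p.1 j - p.2 j| ≤ 1}
            (pointInd y) (fun j : Fin d => if i = j then -1 else 1) ≠ some (-1)) ↔
          η i = true := by
  refine ⟨fun j => if η j = true then 0 else 1, fun j => by dsimp only; split_ifs <;> simp,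
    fun i => ?_⟩
  rw [corrupt_pointInd_ne_neg_one_iff ⟨fun j => if i = j then -1 else 1, by simp⟩]
  simp only [Set.mem_ofPred_eq]
  constructor
  · intro h
    by_contra hi
    have := h i
    simp [hi] at this
  · intro hi j
    by_cases hij : i = j
    · subst hij
      simp [hi]
    · by_cases hj : η j = true <;> simp [hij, hj]

/-- **The corrupted point-indicator class shatters `d` labeled points under an `ℓ∞`
adversary of budget 1.**  With `R = {(x,y) : ‖x − y‖_∞ ≤ 1}` on `ℤ^d`,
`(x_i)_j = -1` if `i = j` and `1` otherwise, all labeled `-1`, the corrupted loss class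
of `H = {h_z : z ∈ ℤ^d}` achieves all `2^d` loss patterns on `((x₀,-1),…,(x_{d-1},-1))`,
each witnessed by some `y ∈ {0,1}^d`; consequently `AVC(H,R) ≥ d`. -/
theorem corrupted_point_indicators_shatter
    (d : ℕ) :
    (∀ η : Fin d → Bool, ∃ y : Fin d → ℤ,
      (∀ j : Fin d, y j = 0 ∨ y j = 1) ∧
      ∀ i : Fin d,
        (corrupt {p : (Fin d → ℤ) × (Fin d → ℤ) | ∀ j : Fin d, |p.1 j - p.2 j| ≤ 1}
            (pointInd y) (fun j : Fin d => if i = j then -1 else 1) ≠ some (-1)) ↔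
          η i = true) ∧
    (d : ℕ∞) ≤
      ⨆ (n : ℕ)
        (_ : corruptShatters {h : (Fin d → ℤ) → ℤ | ∃ z : Fin d → ℤ, h = pointInd z}
          {p : (Fin d → ℤ) × (Fin d → ℤ) | ∀ j : Fin d, |p.1 j - p.2 j| ≤ 1} n),
      (n : ℕ∞) := by
  refine ⟨exists_cube_vertex_corrupt_iff, ?_⟩
  refine le_iSup₂_of_le d ⟨fun i j => if i = j then -1 else 1, fun _ => -1,
    fun _ => Or.inl rfl, fun η => ?_⟩ le_rfl
  obtain ⟨y, -, hy⟩ := exists_cube_vertex_corrupt_iff η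
  exact ⟨pointInd y, ⟨y, rfl⟩, hy⟩
end

section
/- For every d ∈ ℕ, there exist a set X, an adversarial constraint R ⊆ X × X with all neighborhoods nonempty, and a hypothesis class H of functions X → {−1,1} such that VC(H) = 1 and AVC(H,R) ≥ d; that is, the adversarial VC dimension can be arbitrarily larger than the standard VC dimension. -/
attribute [local instance] Classical.propDecidable

/-- `H` achieves all `2^n` labelings on some `n`-tuple of points of `X`; the
VC-dimension `VC(H)` is the supremum of such `n`. -/
def shattersVC {X : Type*} (H : Set (X → ℤ)) (n : ℕ) : Prop :=
  ∃ y : Fin n → X, ∀ η : Fin n → Bool, ∃ h ∈ H,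
    ∀ j : Fin n, (h (y j) = 1 ↔ η j = true)

/-- The hypothesis on `ℕ × (ℕ → Bool)` attached to `s : ℕ → Bool`: it is `-1` exactly at the
points `(j, s)` with `s j = true`. -/
noncomputable def fiberHyp (s : ℕ → Bool) (p : ℕ × (ℕ → Bool)) : ℤ :=
  if p.2 = s ∧ s p.1 = true then -1 else 1

/-- Two points of `ℕ × (ℕ → Bool)` related when they have the same first coordinate. -/
def fiberRel : Set ((ℕ × (ℕ → Bool)) × (ℕ × (ℕ → Bool))) :=
  {q | q.1.1 = q.2.1}

lemma fiberHyp_eq_one_iff (s : ℕ → Bool) (p : ℕ × (ℕ → Bool)) :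
    fiberHyp s p = 1 ↔ ¬ (p.2 = s ∧ s p.1 = true) := by
  unfold fiberHyp
  split_ifs with h <;> simp [h]

lemma corrupt_eq_some_one_iff {X : Type*} (R : Set (X × X)) (h : X → ℤ) (x : X) :
    corrupt R h x = some 1 ↔ ∀ y, (x, y) ∈ R → h y = 1 := by
  unfold corrupt
  split_ifs with h₁ h₂
  · simpa using h₁
  · simpa using h₁
  · simpa using h₁

lemma corrupt_fiberHyp_eq_some_one_iff (s : ℕ → Bool) (p : ℕ × (ℕ → Bool)) :
    corrupt fiberRel (fiberHyp s) p = some 1 ↔ s p.1 = false := by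
  rw [corrupt_eq_some_one_iff]
  constructor
  · intro h
    have := (fiberHyp_eq_one_iff s (p.1, s)).1 (h (p.1, s) rfl)
    simpa using this
  · intro h y hy
    have hy' : p.1 = y.1 := hy
    rw [fiberHyp_eq_one_iff, ← hy', h]
    simp

lemma corruptShatters_range_fiberHyp (n : ℕ) :
    corruptShatters (Set.range fiberHyp) fiberRel n := by
  refine ⟨fun j => (j, fun _ => false), fun _ => 1, fun _ => Or.inr rfl, fun η => ?_⟩
  refine ⟨_, ⟨fun k => if hk : k < n then η ⟨k, hk⟩ else false, rfl⟩, fun j => ?_⟩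
  rw [ne_eq, corrupt_fiberHyp_eq_some_one_iff]
  simp

lemma shattersVC_range_fiberHyp_one : shattersVC (Set.range fiberHyp) 1 := by
  refine ⟨fun _ => (0, fun _ => true), fun η => ⟨_, ⟨fun _ => !η 0, rfl⟩, fun j => ?_⟩⟩
  rw [fiberHyp_eq_one_iff, Subsingleton.elim j 0]
  cases η 0 <;> simp [funext_iff]

lemma le_one_of_shattersVC_range_fiberHyp {n : ℕ} (h : shattersVC (Set.range fiberHyp) n) :
    n ≤ 1 := by
  by_contra! hn
  obtain ⟨y, hy⟩ := h
  let i : Fin n := ⟨0, by omega⟩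
  let k : Fin n := ⟨1, hn⟩
  have hik : i ≠ k := by simp [i, k]
  obtain ⟨_, ⟨a, rfl⟩, ha⟩ := hy fun _ => false
  obtain ⟨_, ⟨b, rfl⟩, hb⟩ := hy fun j => decide (j = k)
  have ha₀ := ha i
  have ha₁ := ha k
  have hb₀ := hb i
  have hb₁ := hb k
  simp only [fiberHyp_eq_one_iff, hik, decide_true, decide_false, iff_true, Bool.false_eq_true,
    iff_false, not_not] at ha₀ ha₁ hb₀ hb₁
  obtain rfl : a = b := ha₀.1.symm.trans hb₀.1
  exact hb₁ ha₁

/-- **The adversarial VC-dimension can be arbitrarily larger than the VC-dimension.**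
For every `d ∈ ℕ` there are a set `X`, an adversarial constraint `R ⊆ X × X` with all
neighborhoods nonempty, and a hypothesis class `H` of `{-1,1}`-valued functions on `X`
(labels encoded as integers) such that `VC(H) = 1` while `AVC(H,R) ≥ d`. -/
theorem adversarial_vc_can_exceed_vc (d : ℕ) :
    ∃ (X : Type) (R : Set (X × X)) (H : Set (X → ℤ)),
      (∀ x : X, ∃ y : X, (x, y) ∈ R) ∧
      (∀ h ∈ H, ∀ x : X, h x = -1 ∨ h x = 1) ∧
      (⨆ (n : ℕ) (_ : shattersVC H n), (n : ℕ∞)) = 1 ∧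
      (d : ℕ∞) ≤ ⨆ (n : ℕ) (_ : corruptShatters H R n), (n : ℕ∞) := by
  refine ⟨ℕ × (ℕ → Bool), fiberRel, Set.range fiberHyp, fun x => ⟨x, rfl⟩, ?_, ?_, ?_⟩
  · rintro _ ⟨s, rfl⟩ x
    unfold fiberHyp
    split_ifs <;> simp
  · apply le_antisymm
    · exact iSup₂_le fun n hn => by exact_mod_cast le_one_of_shattersVC_range_fiberHyp hn
    · exact le_iSup₂_of_le 1 shattersVC_range_fiberHyp_one (by simp)
  · exact le_iSup₂_of_le d (corruptShatters_range_fiberHyp d) le_rfl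
end

section
/- Let W be a finite-dimensional real vector space with dim(W) = m, let B ⊆ W be a nonempty, convex, origin-symmetric set, and let H be the family of all functions h : W → {−1,1} such that both h⁻¹({1}) and h⁻¹({−1}) are convex (generalized halfspace classifiers). Then for every n ≥ m + 2, every x ∈ W^n, and every c ∈ {−1,1}^n, there exists an error pattern η ∈ {0,1}^n that is not achieved by any h ∈ H; i.e., there is no h ∈ H such that for every i, η_i = 1 exactly when there exists δ ∈ B with h(x_i + δ) ≠ c_i. -/
open Finset in
/-- More than `dim W + 1` points of `W` satisfy a nontrivial affine relation. -/
theorem exists_affine_relation_of_finrank_add_two_le {ι W : Type*} [Fintype ι]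
    [AddCommGroup W] [Module ℝ W] [FiniteDimensional ℝ W] (x : ι → W)
    (hcard : Module.finrank ℝ W + 2 ≤ Fintype.card ι) :
    ∃ w : ι → ℝ, ∑ i, w i = 0 ∧ ∑ i, w i • x i = 0 ∧ ∃ i, w i ≠ 0 := by
  have hdep : ¬ LinearIndependent ℝ (fun i => ((1 : ℝ), x i)) := by
    intro hli
    have hle := hli.fintype_card_le_finrank
    rw [Module.finrank_prod, Module.finrank_self] at hle
    omega
  obtain ⟨w, hw, hne⟩ := Fintype.not_linearIndependent_iff.1 hdep
  refine ⟨w, ?_, ?_, hne⟩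
  · simpa [Prod.fst_sum] using congrArg Prod.fst hw
  · simpa [Prod.snd_sum] using congrArg Prod.snd hw

open Finset in
/-- A normalized nonnegative combination of points, of which those with nonzero weight lie in a
convex set, lies in that set. -/
theorem Convex.inv_smul_sum_mem {ι W : Type*} [Fintype ι] [AddCommGroup W] [Module ℝ W]
    {s : Set W} (hs : Convex ℝ s) {u : ι → ℝ} {y : ι → W} (hu : ∀ i, 0 ≤ u i)
    (hpos : 0 < ∑ i, u i) (hy : ∀ i, 0 < u i → y i ∈ s) :
    (∑ i, u i)⁻¹ • ∑ i, u i • y i ∈ s := by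
  have hmem := hs.finsum_mem (w := fun i => (∑ j, u j)⁻¹ * u i) (z := y)
    (fun i => mul_nonneg (inv_nonneg.2 hpos.le) (hu i))
    (by rw [finsum_eq_sum_of_fintype, ← mul_sum, inv_mul_cancel₀ hpos.ne'])
    (fun i hi => hy i ((hu i).lt_of_ne' (right_ne_zero_of_mul hi)))
  rw [finsum_eq_sum_of_fintype] at hmem
  simpa only [smul_sum, smul_smul] using hmem

open Finset in
/-- A nonnegative combination of points of a convex set containing `0`, of total weight at most
`a`, is `a` times a point of the set. -/
theorem Convex.exists_sum_smul_eq_smul {ι W : Type*} [Fintype ι] [AddCommGroup W] [Module ℝ W]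
    {s : Set W} (hs : Convex ℝ s) (h0 : (0 : W) ∈ s) {u : ι → ℝ} {y : ι → W}
    (hu : ∀ i, 0 ≤ u i) (hy : ∀ i, y i ∈ s) {a : ℝ} (ha : ∑ i, u i ≤ a) :
    ∃ z ∈ s, ∑ i, u i • y i = a • z := by
  rcases (sum_nonneg fun i _ => hu i : 0 ≤ ∑ i, u i).eq_or_lt with h | h
  · refine ⟨0, h0, ?_⟩
    have hzero := (sum_eq_zero_iff_of_nonneg fun i _ => hu i).1 h.symm
    rw [smul_zero]
    exact sum_eq_zero fun i hi => by rw [hzero i hi, zero_smul]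
  · have hapos : 0 < a := h.trans_le ha
    refine ⟨((∑ i, u i) / a) • ((∑ i, u i)⁻¹ • ∑ i, u i • y i),
      hs.smul_mem_of_zero_mem h0 (hs.inv_smul_sum_mem hu h fun i _ => hy i)
        ⟨(div_pos h hapos).le, (div_le_one hapos).2 ha⟩, ?_⟩
    rw [smul_smul, smul_smul, mul_div_cancel₀ _ hapos.ne', mul_inv_cancel₀ h.ne', one_smul]

open Finset in
/-- The two parts of a nontrivial affine relation cannot be separated by disjoint convex sets. -/
theorem not_disjoint_of_affine_relation {ι W : Type*} [Fintype ι] [AddCommGroup W] [Module ℝ W]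
    {s t : Set W} (hs : Convex ℝ s) (ht : Convex ℝ t) {w : ι → ℝ} {y : ι → W}
    (hw : ∑ i, w i = 0) (hwy : ∑ i, w i • y i = 0) (hne : ∃ i, w i ≠ 0)
    (hys : ∀ i, 0 < w i → y i ∈ s) (hyt : ∀ i, w i < 0 → y i ∈ t) : ¬ Disjoint s t := by
  have hsplit : ∀ i, w i = max (w i) 0 - max (-w i) 0 := fun i => by
    rcases le_total (w i) 0 with h | h <;> simp [h]
  have hsum : ∑ i, max (w i) 0 = ∑ i, max (-w i) 0 := by
    rw [← sub_eq_zero, ← sum_sub_distrib]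
    exact (sum_congr rfl fun i _ => (hsplit i).symm).trans hw
  have hsumy : ∑ i, max (w i) 0 • y i = ∑ i, max (-w i) 0 • y i := by
    rw [← sub_eq_zero, ← sum_sub_distrib, ← hwy]
    exact sum_congr rfl fun i _ => by rw [← sub_smul, ← hsplit i]
  have hpos : 0 < ∑ i, max (w i) 0 := by
    obtain ⟨i, hi⟩ := hne
    rcases hi.lt_or_gt with h | h
    · rw [hsum]
      exact sum_pos' (fun _ _ => le_max_right _ _)
        ⟨i, mem_univ i, lt_max_of_lt_left (neg_pos.2 h)⟩
    · exact sum_pos' (fun _ _ => le_max_right _ _) ⟨i, mem_univ i, lt_max_of_lt_left h⟩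
  have hmem_s := hs.inv_smul_sum_mem (fun i => le_max_right (w i) 0) hpos
    (fun i hi => hys i (by simpa using hi))
  have hmem_t := ht.inv_smul_sum_mem (fun i => le_max_right (-w i) 0) (hsum ▸ hpos)
    (fun i hi => hyt i (by simpa using hi))
  rw [← hsum, ← hsumy] at hmem_t
  exact Set.not_disjoint_iff.2 ⟨_, hmem_s, hmem_t⟩

open Finset in
/-- Given labels `k i = ±1` and weights `w` with `∑ k i * w i ≥ 0`, perturbations `d i` in a convex
symmetric set that are prescribed where `k i * w i < 0` extend to perturbations whose
`w`-weighted sum vanishes. -/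
theorem exists_balanced_perturbation {ι W : Type*} [Fintype ι] [AddCommGroup W] [Module ℝ W]
    {B : Set W} (hBne : B.Nonempty) (hBconv : Convex ℝ B) (hBsym : ∀ z ∈ B, -z ∈ B)
    {w k : ι → ℝ} (hk : ∀ i, k i = -1 ∨ k i = 1) (hkw : 0 ≤ ∑ i, k i * w i)
    {d : ι → W} (hd : ∀ i, d i ∈ B) :
    ∃ e : ι → W, (∀ i, e i ∈ B) ∧ (∀ i, k i * w i < 0 → e i = d i) ∧
      ∑ i, w i • e i = 0 := by
  have h0 : (0 : W) ∈ B := by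
    obtain ⟨b, hb⟩ := hBne
    have hmid := hBconv hb (hBsym b hb) (by norm_num : (0 : ℝ) ≤ 1 / 2)
      (by norm_num : (0 : ℝ) ≤ 1 / 2) (by norm_num)
    simpa using hmid
  have hsign : ∀ i, ∀ z ∈ B, k i • z ∈ B := fun i z hz => by
    rcases hk i with h | h
    · simpa [h] using hBsym z hz
    · simpa [h] using hz
  have hle : ∑ i, max (-(k i * w i)) 0 ≤ ∑ i, max (k i * w i) 0 := by
    rw [← sub_nonneg, ← sum_sub_distrib]
    refine hkw.trans_eq (sum_congr rfl fun i _ => ?_)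
    rcases le_total (k i * w i) 0 with h | h <;> simp [h]
  obtain ⟨z, hz, hsum⟩ := hBconv.exists_sum_smul_eq_smul h0
    (fun i => le_max_right (-(k i * w i)) 0) (fun i => hsign i (d i) (hd i)) hle
  refine ⟨fun i => if k i * w i < 0 then d i else k i • z, fun i => ?_, fun i hi => if_pos hi, ?_⟩
  · dsimp only
    split_ifs
    exacts [hd i, hsign i z hz]
  · have hterm : ∀ i, w i • (if k i * w i < 0 then d i else k i • z) =
        max (k i * w i) 0 • z - max (-(k i * w i)) 0 • k i • d i := by
      intro i
      have hsq : k i * k i = 1 := by rcases hk i with h | h <;> norm_num [h]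
      split_ifs with h
      · rw [max_eq_right h.le, max_eq_left (neg_pos.2 h).le, zero_smul, zero_sub, smul_smul,
          ← neg_smul]
        congr 1
        linear_combination -(w i) * hsq
      · rw [max_eq_left (not_lt.1 h), max_eq_right (neg_nonpos.2 (not_lt.1 h)), zero_smul,
          sub_zero, smul_smul, mul_comm]
    rw [sum_congr rfl fun i _ => hterm i, sum_sub_distrib, hsum, ← sum_smul, sub_self]

/-- **Generalized halfspace classifiers miss an error pattern on any `m + 2` labeled
points.**  Let `W` be a finite-dimensional real vector space with `dim W = m`, let
`B ⊆ W` be nonempty, convex and origin-symmetric, and let `H` be the family of all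
`{-1,1}`-valued functions (labels encoded as integers) whose two label preimages are
both convex.  Then for every `n ≥ m + 2`, every `x ∈ Wⁿ` and every `c ∈ {-1,1}ⁿ`,
there is an error pattern `η ∈ {0,1}ⁿ` achieved by no `h ∈ H`, where `h` achieves `η`
if for every `i`, `η_i = 1` exactly when some `δ ∈ B` has `h (x_i + δ) ≠ c_i`. -/
theorem generalized_halfspaces_miss_error_pattern
    (W : Type*) [AddCommGroup W] [Module ℝ W] [FiniteDimensional ℝ W]
    (m : ℕ) (hm : Module.finrank ℝ W = m)
    (B : Set W) (hBne : B.Nonempty) (hBconv : Convex ℝ B)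
    (hBsym : ∀ z ∈ B, -z ∈ B)
    (n : ℕ) (hn : m + 2 ≤ n)
    (x : Fin n → W) (c : Fin n → ℤ) (hc : ∀ i : Fin n, c i = -1 ∨ c i = 1) :
    ∃ η : Fin n → Bool, ∀ h : W → ℤ,
      (∀ z : W, h z = -1 ∨ h z = 1) →
      Convex ℝ {z : W | h z = 1} →
      Convex ℝ {z : W | h z = -1} →
      ¬ ∀ i : Fin n, ((∃ δ ∈ B, h (x i + δ) ≠ c i) ↔ η i = true) := by
  obtain ⟨w, hw, hwx, hne, hcw⟩ : ∃ w : Fin n → ℝ, ∑ i, w i = 0 ∧ ∑ i, w i • x i = 0 ∧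
      (∃ i, w i ≠ 0) ∧ 0 ≤ ∑ i, (c i : ℝ) * w i := by
    obtain ⟨w, hw, hwx, hne⟩ := exists_affine_relation_of_finrank_add_two_le x
      (by rw [hm, Fintype.card_fin]; exact hn)
    rcases le_total 0 (∑ i, (c i : ℝ) * w i) with h | h
    · exact ⟨w, hw, hwx, hne, h⟩
    · exact ⟨fun i => -w i, by simp [hw], by simp [hwx], by simpa using hne, by simpa using h⟩
  have hk : ∀ i, (c i : ℝ) = -1 ∨ (c i : ℝ) = 1 := fun i => by
    rcases hc i with h | h <;> simp [h]
  refine ⟨fun i => decide ((c i : ℝ) * w i < 0), fun h hh hP hN hη => ?_⟩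
  simp only [decide_eq_true_eq] at hη
  have hchoice : ∀ i, ∃ d ∈ B, (c i : ℝ) * w i < 0 → h (x i + d) ≠ c i := fun i => by
    by_cases hi : (c i : ℝ) * w i < 0
    · obtain ⟨d, hd, hne⟩ := (hη i).2 hi
      exact ⟨d, hd, fun _ => hne⟩
    · obtain ⟨b, hb⟩ := hBne
      exact ⟨b, hb, fun hi' => absurd hi' hi⟩
  choose d hdB hd using hchoice
  obtain ⟨e, heB, hed, hwe⟩ := exists_balanced_perturbation hBne hBconv hBsym hk hcw hdB
  have herr : ∀ i, h (x i + e i) ≠ c i ↔ (c i : ℝ) * w i < 0 := fun i =>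
    ⟨fun hi => (hη i).1 ⟨e i, heB i, hi⟩, fun hi => by rw [hed i hi]; exact hd i hi⟩
  refine not_disjoint_of_affine_relation hP hN (y := fun i => x i + e i) hw
    (by simp only [smul_add, Finset.sum_add_distrib, hwx, hwe, add_zero]) hne
    (fun i hi => ?_) (fun i hi => ?_) (Set.disjoint_left.2 fun z hz hz' => ?_)
  · have := herr i
    rcases hc i with h1 | h1 <;> rcases hh (x i + e i) with h2 | h2 <;>
      simp_all [not_lt_of_gt hi]
  · have := herr i
    rcases hc i with h1 | h1 <;> rcases hh (x i + e i) with h2 | h2 <;>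
      simp_all [not_lt_of_gt hi]
  · rw [Set.mem_ofPred_eq] at hz hz'
    omega
end
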